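/- Let q ≥ k+1 and let u be a polynomial of degree at most k. Let y be the backward flow map x ↦ y_x(−Δt) of a C^q vector field b with ‖b'‖_{L^∞} = L, restricted to the interval [0,T] of times. Then on any interval J where u∘y is smooth, there is a constant C (depending on b, k, q, T) such that ‖ d^q/dx^q (u(y(x))) ‖_{L^∞(J)} ≤ C Δt Σ_{p=1}^{k} ‖u^{(p)}‖_{L^∞(y(J))}. -/

import Mathlib

open MeasureTheory Set Filter Topology

/-- A one-parameter family of functions, separately continuous, bounded by a multiple of the weight
`w t` uniformly in space and locally uniformly in the parameter `t`. -/
def LocBdd (w : ℝ → ℝ) (F : ℝ → ℝ → ℝ) : Prop :=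
  (∀ x, Continuous fun t => F t x) ∧ (∀ t, Continuous (F t)) ∧
    ∀ R, ∃ C, 0 ≤ C ∧ ∀ t, |t| ≤ R → ∀ x, |F t x| ≤ C * w t

/-- The family `F` and its spatial derivatives up to order `n` all satisfy `LocBdd w`. -/
def LocBddDeriv (w : ℝ → ℝ) : ℕ → (ℝ → ℝ → ℝ) → Prop
  | 0, F => LocBdd w F
  | n + 1, F => LocBdd w F ∧ ∃ G, (∀ t x, HasDerivAt (F t) (G t x) x) ∧ LocBddDeriv w n G

namespace LocBdd

variable {w : ℝ → ℝ} {F G : ℝ → ℝ → ℝ}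

theorem add (hF : LocBdd w F) (hG : LocBdd w G) : LocBdd w fun t x => F t x + G t x := by
  refine ⟨fun x => (hF.1 x).add (hG.1 x), fun t => (hF.2.1 t).add (hG.2.1 t), fun R => ?_⟩
  obtain ⟨C, hC, h⟩ := hF.2.2 R
  obtain ⟨D, hD, h'⟩ := hG.2.2 R
  refine ⟨C + D, by positivity, fun t ht x => (abs_add_le _ _).trans ?_⟩
  linarith [h t ht x, h' t ht x]

theorem mul (hF : LocBdd w F) (hG : LocBdd (fun _ => 1) G) :
    LocBdd w fun t x => F t x * G t x := by
  refine ⟨fun x => (hF.1 x).mul (hG.1 x), fun t => (hF.2.1 t).mul (hG.2.1 t), fun R => ?_⟩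
  obtain ⟨C, hC, h⟩ := hF.2.2 R
  obtain ⟨D, hD, h'⟩ := hG.2.2 R
  refine ⟨C * D, by positivity, fun t ht x => ?_⟩
  rw [abs_mul]
  have h1 := h t ht x
  have h2 := h' t ht x
  calc |F t x| * |G t x| ≤ (C * w t) * (D * 1) :=
        mul_le_mul h1 h2 (abs_nonneg _) ((abs_nonneg _).trans h1)
    _ = C * D * w t := by ring

theorem exp (hF : LocBdd (fun _ => 1) F) : LocBdd (fun _ => 1) fun t x => Real.exp (F t x) := by
  refine ⟨fun x => (hF.1 x).rexp, fun t => (hF.2.1 t).rexp, fun R => ?_⟩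
  obtain ⟨C, -, h⟩ := hF.2.2 R
  refine ⟨Real.exp C, (Real.exp_pos _).le, fun t ht x => ?_⟩
  rw [abs_of_pos (Real.exp_pos _), mul_one]
  exact Real.exp_le_exp.2 ((le_abs_self _).trans (by simpa using h t ht x))

theorem of_abs (hF : LocBdd (fun t => |t|) F) : LocBdd (fun _ => 1) F := by
  refine ⟨hF.1, hF.2.1, fun R => ?_⟩
  obtain ⟨C, hC, h⟩ := hF.2.2 R
  refine ⟨C * |R|, by positivity, fun t ht x => (h t ht x).trans ?_⟩
  rw [mul_one]
  exact mul_le_mul_of_nonneg_left (ht.trans (le_abs_self R)) hC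

theorem exists_bound (hF : LocBdd (fun _ => 1) F) (t : ℝ) :
    ∃ C, ∀ s ∈ uIoc 0 t, ∀ x, |F s x| ≤ C := by
  obtain ⟨C, -, h⟩ := hF.2.2 |t|
  refine ⟨C, fun s hs x => (h s ?_ x).trans_eq (mul_one C)⟩
  simpa using abs_sub_left_of_mem_uIcc (uIoc_subset_uIcc hs)

theorem integral (hF : LocBdd (fun _ => 1) F) :
    LocBdd (fun t => |t|) fun t x => ∫ s in (0 : ℝ)..t, F s x := by
  refine ⟨fun x => ?_, fun t => ?_, fun R => ?_⟩
  · exact intervalIntegral.continuous_primitive (fun _ _ => (hF.1 x).intervalIntegrable _ _) 0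
  · obtain ⟨C, hC⟩ := hF.exists_bound t
    refine continuous_iff_continuousAt.2 fun x =>
      intervalIntegral.continuousAt_of_dominated_interval (bound := fun _ => C)
        (Eventually.of_forall fun z => (hF.1 z).aestronglyMeasurable)
        (Eventually.of_forall fun z => Eventually.of_forall fun s hs => hC s hs z)
        intervalIntegrable_const
        (Eventually.of_forall fun s _ => (hF.2.1 s).continuousAt)
  · obtain ⟨C, hC, h⟩ := hF.2.2 R
    refine ⟨C, hC, fun t ht x => ?_⟩
    have := intervalIntegral.norm_integral_le_of_norm_le_const (a := 0) (b := t) (C := C)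
      (f := fun s => F s x) fun s hs => (h s (le_trans
        (by simpa using abs_sub_left_of_mem_uIcc (uIoc_subset_uIcc hs)) ht) x).trans_eq (mul_one C)
    simpa using this

theorem hasDerivAt_integral (hF : LocBdd (fun _ => 1) F) (hG : LocBdd (fun _ => 1) G)
    (hFG : ∀ t x, HasDerivAt (F t) (G t x) x) (t x : ℝ) :
    HasDerivAt (fun x => ∫ s in (0 : ℝ)..t, F s x) (∫ s in (0 : ℝ)..t, G s x) x := by
  obtain ⟨C, hC⟩ := hG.exists_bound t
  exact (intervalIntegral.hasDerivAt_integral_of_dominated_loc_of_deriv_le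
    (F := fun x s => F s x) (F' := fun x s => G s x) (bound := fun _ => C) univ_mem
    (Eventually.of_forall fun z => (hF.1 z).aestronglyMeasurable)
    ((hF.1 x).intervalIntegrable _ _) (hG.1 x).aestronglyMeasurable
    (Eventually.of_forall fun s hs z _ => hC s hs z) intervalIntegrable_const
    (Eventually.of_forall fun s _ z _ => hFG s z)).2

end LocBdd

namespace LocBddDeriv

variable {w : ℝ → ℝ} {n : ℕ} {F G : ℝ → ℝ → ℝ}

theorem locBdd (hF : LocBddDeriv w n F) : LocBdd w F := by
  cases n with
  | zero => exact hF
  | succ n => exact hF.1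

theorem of_succ (hF : LocBddDeriv w (n + 1) F) : LocBddDeriv w n F := by
  induction n generalizing F with
  | zero => exact hF.1
  | succ n ih =>
    obtain ⟨h, G, hG, hG'⟩ := hF
    exact ⟨h, G, hG, ih hG'⟩

theorem of_le {m : ℕ} (hF : LocBddDeriv w n F) (hmn : m ≤ n) : LocBddDeriv w m F := by
  induction n, hmn using Nat.le_induction with
  | base => exact hF
  | succ n _ ih => exact ih hF.of_succ

theorem add (hF : LocBddDeriv w n F) (hG : LocBddDeriv w n G) :
    LocBddDeriv w n fun t x => F t x + G t x := by
  induction n generalizing F G with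
  | zero => exact LocBdd.add hF hG
  | succ n ih =>
    obtain ⟨h, F', hF', h'⟩ := hF
    obtain ⟨k, G', hG', k'⟩ := hG
    exact ⟨h.add k, _, fun t x => (hF' t x).add (hG' t x), ih h' k'⟩

theorem mul (hF : LocBddDeriv w n F) (hG : LocBddDeriv (fun _ => 1) n G) :
    LocBddDeriv w n fun t x => F t x * G t x := by
  induction n generalizing F G with
  | zero => exact LocBdd.mul hF hG
  | succ n ih =>
    have hFn := hF.of_succ
    have hGn := hG.of_succ
    obtain ⟨h, F', hF', h'⟩ := hF
    obtain ⟨k, G', hG', k'⟩ := hG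
    exact ⟨h.mul k, _, fun t x => (hF' t x).mul (hG' t x), (ih h' hGn).add (ih hFn k')⟩

theorem exp (hF : LocBddDeriv (fun _ => 1) n F) :
    LocBddDeriv (fun _ => 1) n fun t x => Real.exp (F t x) := by
  induction n generalizing F with
  | zero => exact LocBdd.exp hF
  | succ n ih =>
    have hFn := hF.of_succ
    obtain ⟨h, F', hF', h'⟩ := hF
    exact ⟨h.exp, _, fun t x => (hF' t x).exp, (ih hFn).mul h'⟩

theorem of_abs (hF : LocBddDeriv (fun t => |t|) n F) : LocBddDeriv (fun _ => 1) n F := by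
  induction n generalizing F with
  | zero => exact LocBdd.of_abs hF
  | succ n ih =>
    obtain ⟨h, F', hF', h'⟩ := hF
    exact ⟨h.of_abs, F', hF', ih h'⟩

theorem integral (hF : LocBddDeriv (fun _ => 1) n F) :
    LocBddDeriv (fun t => |t|) n fun t x => ∫ s in (0 : ℝ)..t, F s x := by
  induction n generalizing F with
  | zero => exact LocBdd.integral hF
  | succ n ih =>
    obtain ⟨h, F', hF', h'⟩ := hF
    exact ⟨h.integral, _, h.hasDerivAt_integral h'.locBdd hF', ih h'⟩

theorem const (c : ℝ) : LocBddDeriv (fun _ => 1) n fun _ _ => c := by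
  have key (c : ℝ) : LocBdd (fun _ => 1) fun _ _ => c :=
    ⟨fun _ => continuous_const, fun _ => continuous_const,
      fun _ => ⟨|c|, abs_nonneg c, fun _ _ _ => (mul_one |c|).ge⟩⟩
  induction n generalizing c with
  | zero => exact key c
  | succ n ih => exact ⟨key c, _, fun _ x => hasDerivAt_const x c, ih 0⟩

theorem contDiff (hF : LocBddDeriv w n F) (t : ℝ) : ContDiff ℝ n (F t) := by
  induction n generalizing F with
  | zero => exact contDiff_zero.2 (hF.2.1 t)
  | succ n ih =>
    obtain ⟨-, G, hG, hG'⟩ := hF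
    have hd : deriv (F t) = G t := funext fun x => (hG t x).deriv
    rw [Nat.cast_add_one, contDiff_succ_iff_deriv]
    exact ⟨fun x => (hG t x).differentiableAt, by simp, by rw [hd]; exact ih hG'⟩

end LocBddDeriv

theorem Function.Periodic.deriv {g : ℝ → ℝ} {c : ℝ} (hg : Function.Periodic g c) :
    Function.Periodic (deriv g) c := fun x => by
  rw [← deriv_comp_add_const, show (fun x => g (x + c)) = g from funext hg]

theorem LocBdd.periodic_comp {φ : ℝ → ℝ → ℝ} {c : ℝ} (hc : c ≠ 0)
    (hφt : ∀ x, Continuous fun t => φ t x) (hφx : ∀ t, Continuous (φ t)) {g : ℝ → ℝ}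
    (hg : Continuous g) (hper : Function.Periodic g c) :
    LocBdd (fun _ => 1) fun t x => g (φ t x) := by
  refine ⟨fun x => hg.comp (hφt x), fun t => hg.comp (hφx t), fun R => ?_⟩
  obtain ⟨C, hC⟩ := (hper.isBounded_of_continuous hc hg).exists_norm_le
  refine ⟨C, (norm_nonneg _).trans (hC _ (mem_range_self 0)), fun t _ x => ?_⟩
  simpa using hC _ (mem_range_self (φ t x))

/-- Composing a periodic `C^n` function with a family whose spatial derivative is controlled. -/
theorem LocBddDeriv.periodic_comp {φ v : ℝ → ℝ → ℝ} {c : ℝ} (hc : c ≠ 0)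
    (hφ : ∀ x, Continuous fun t => φ t x) (hv : ∀ t x, HasDerivAt (φ t) (v t x) x) {n : ℕ}
    (hvn : ∀ m < n, LocBddDeriv (fun _ => 1) m v) {g : ℝ → ℝ} (hg : ContDiff ℝ n g)
    (hper : Function.Periodic g c) : LocBddDeriv (fun _ => 1) n fun t x => g (φ t x) := by
  have hφx (t : ℝ) : Continuous (φ t) :=
    continuous_iff_continuousAt.2 fun x => (hv t x).continuousAt
  induction n generalizing g with
  | zero => exact LocBdd.periodic_comp hc hφ hφx hg.continuous hper
  | succ n ih =>
    have hg' : ContDiff ℝ ((n : WithTop ℕ∞) + 1) g := by exact_mod_cast hg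
    obtain ⟨hd, -, hdn⟩ := contDiff_succ_iff_deriv.1 hg'
    exact ⟨LocBdd.periodic_comp hc hφ hφx hg.continuous hper, _,
      fun t x => (hd (φ t x)).hasDerivAt.comp x (hv t x),
      (ih (fun m hm => hvn m (by omega)) hdn hper.deriv).mul (hvn n (by omega))⟩

/-- Solutions of the scalar linear equation `d' = a d`. -/
theorem eq_mul_exp_integral_of_hasDerivAt {a d : ℝ → ℝ} (ha : Continuous a)
    (hd : ∀ t, HasDerivAt d (a t * d t) t) (t : ℝ) :
    d t = d 0 * Real.exp (∫ s in (0 : ℝ)..t, a s) := by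
  have hI (t : ℝ) : HasDerivAt (fun t => ∫ s in (0 : ℝ)..t, a s) (a t) t :=
    (ha.integral_hasStrictDerivAt 0 t).hasDerivAt
  have hE (t : ℝ) : HasDerivAt (fun t => d t * Real.exp (-∫ s in (0 : ℝ)..t, a s)) 0 t := by
    refine ((hd t).mul (hI t).neg.exp).congr_deriv ?_
    ring
  have := is_const_of_deriv_eq_zero (fun t => (hE t).differentiableAt)
    (fun t => (hE t).deriv) t 0
  simp only [intervalIntegral.integral_same, neg_zero, Real.exp_zero, mul_one] at this
  rw [← this, mul_assoc, ← Real.exp_add, neg_add_cancel, Real.exp_zero, mul_one]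

section Flow

variable {b : ℝ → ℝ} {L : ℝ} {y : ℝ → ℝ → ℝ}

/-- The mean of `b'` over the segment from `u` to `v`. -/
noncomputable def meanDeriv (b : ℝ → ℝ) (u v : ℝ) : ℝ :=
  ∫ θ in (0 : ℝ)..1, deriv b (u + θ * (v - u))

theorem continuous_meanDeriv (hb : ContDiff ℝ 1 b) :
    Continuous fun p : ℝ × ℝ => meanDeriv b p.1 p.2 := by
  have := hb.continuous_deriv le_rfl
  refine intervalIntegral.continuous_parametric_intervalIntegral_of_continuous'
    (f := fun (p : ℝ × ℝ) θ => deriv b (p.1 + θ * (p.2 - p.1))) ?_ 0 1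
  exact this.comp (by fun_prop)

theorem abs_meanDeriv_le (hL : ∀ x, |deriv b x| ≤ L) (u v : ℝ) : |meanDeriv b u v| ≤ L := by
  simpa [meanDeriv] using intervalIntegral.norm_integral_le_of_norm_le_const (a := 0) (b := 1)
    (f := fun θ => deriv b (u + θ * (v - u))) fun θ _ => hL (u + θ * (v - u))

theorem meanDeriv_self (b : ℝ → ℝ) (u : ℝ) : meanDeriv b u u = deriv b u := by
  simp [meanDeriv]

theorem meanDeriv_mul_sub (hb : ContDiff ℝ 1 b) (u v : ℝ) :
    meanDeriv b u v * (v - u) = b v - b u := by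
  have hc := hb.continuous_deriv le_rfl
  have hd (θ : ℝ) : HasDerivAt (fun θ => b (u + θ * (v - u)))
      (deriv b (u + θ * (v - u)) * (v - u)) θ := by
    refine ((hb.differentiable one_ne_zero _).hasDerivAt).comp θ ?_
    simpa using ((hasDerivAt_id θ).mul_const (v - u)).const_add u
  have := intervalIntegral.integral_eq_sub_of_hasDerivAt (a := 0) (b := 1) (fun θ _ => hd θ)
    (Continuous.intervalIntegrable (by fun_prop) _ _)
  rw [intervalIntegral.integral_mul_const] at this
  simpa [meanDeriv] using this

theorem flow_sub_flow (hb : ContDiff ℝ 1 b) (hy0 : ∀ x, y x 0 = x)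
    (hyode : ∀ x t, HasDerivAt (y x) (b (y x t)) t) (x z t : ℝ) :
    y z t - y x t =
      (z - x) * Real.exp (∫ s in (0 : ℝ)..t, meanDeriv b (y x s) (y z s)) := by
  have hyc (x : ℝ) : Continuous (y x) :=
    continuous_iff_continuousAt.2 fun t => (hyode x t).continuousAt
  have := eq_mul_exp_integral_of_hasDerivAt (d := fun t => y z t - y x t)
    (a := fun s => meanDeriv b (y x s) (y z s))
    ((continuous_meanDeriv hb).comp ((hyc x).prodMk (hyc z)))
    (fun t => by
      rw [meanDeriv_mul_sub hb]
      exact (hyode z t).sub (hyode x t)) t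
  simpa [hy0] using this

theorem continuous_flow (hb : ContDiff ℝ 1 b) (hL : ∀ x, |deriv b x| ≤ L)
    (hy0 : ∀ x, y x 0 = x) (hyode : ∀ x t, HasDerivAt (y x) (b (y x t)) t) (t : ℝ) :
    Continuous fun x => y x t := by
  refine continuous_iff_continuousAt.2 fun x => ?_
  rw [ContinuousAt, tendsto_iff_norm_sub_tendsto_zero]
  refine squeeze_zero (g := fun z => |z - x| * Real.exp (L * |t|)) (fun _ => norm_nonneg _)
    (fun z => ?_) ?_
  · rw [flow_sub_flow hb hy0 hyode, norm_mul, Real.norm_eq_abs, Real.norm_eq_abs, Real.abs_exp]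
    refine mul_le_mul_of_nonneg_left (Real.exp_le_exp.2 ((le_abs_self _).trans ?_)) (abs_nonneg _)
    simpa using intervalIntegral.norm_integral_le_of_norm_le_const (a := 0) (b := t)
      (f := fun s => meanDeriv b (y x s) (y z s)) fun s _ => abs_meanDeriv_le hL _ _
  · have : Continuous fun z => |z - x| * Real.exp (L * |t|) := by fun_prop
    simpa using this.tendsto x

/-- The flow is differentiable in the initial point. -/
theorem hasDerivAt_flow (hb : ContDiff ℝ 1 b) (hL : ∀ x, |deriv b x| ≤ L)
    (hy0 : ∀ x, y x 0 = x) (hyode : ∀ x t, HasDerivAt (y x) (b (y x t)) t) (t x : ℝ) :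
    HasDerivAt (fun x => y x t) (Real.exp (∫ s in (0 : ℝ)..t, deriv b (y x s))) x := by
  have hyc (x : ℝ) : Continuous (y x) :=
    continuous_iff_continuousAt.2 fun t => (hyode x t).continuousAt
  have hI : ContinuousAt (fun z => ∫ s in (0 : ℝ)..t, meanDeriv b (y x s) (y z s)) x :=
    intervalIntegral.continuousAt_of_dominated_interval (bound := fun _ => L)
      (Eventually.of_forall fun z => ((continuous_meanDeriv hb).comp
        ((hyc x).prodMk (hyc z))).aestronglyMeasurable)
      (Eventually.of_forall fun z => Eventually.of_forall fun s _ => abs_meanDeriv_le hL _ _)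
      intervalIntegrable_const
      (Eventually.of_forall fun s _ => ((continuous_meanDeriv hb).comp
        (continuous_const.prodMk (continuous_flow hb hL hy0 hyode s))).continuousAt)
  have hE := hI.rexp.tendsto
  simp only [meanDeriv_self] at hE
  rw [hasDerivAt_iff_tendsto_slope]
  refine (hE.mono_left nhdsWithin_le_nhds).congr' ?_
  filter_upwards [self_mem_nhdsWithin] with z hz
  rw [slope_def_field, flow_sub_flow hb hy0 hyode, mul_div_cancel_left₀ _ (sub_ne_zero.2 hz)]

/-- The displacement `y_x(t) - x` of a periodic `C^q` flow is `O(t)` with all its spatial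
derivatives up to order `q`. -/
theorem locBddDeriv_flow_sub_id {q : ℕ} (hq : 1 ≤ q) {c : ℝ} (hc : c ≠ 0)
    (hb : ContDiff ℝ q b) (hbper : Function.Periodic b c) (hL : ∀ x, |deriv b x| ≤ L)
    (hy0 : ∀ x, y x 0 = x) (hyode : ∀ x t, HasDerivAt (y x) (b (y x t)) t) :
    LocBddDeriv (fun t => |t|) q fun t x => y x t - x := by
  have hb1 : ContDiff ℝ 1 b := hb.of_le (by exact_mod_cast hq)
  have hyc (x : ℝ) : Continuous fun t => y x t :=
    continuous_iff_continuousAt.2 fun t => (hyode x t).continuousAt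
  have hv := hasDerivAt_flow hb1 hL hy0 hyode
  have hvn : ∀ n < q, LocBddDeriv (fun _ => 1) n
      fun t x => Real.exp (∫ s in (0 : ℝ)..t, deriv b (y x s)) := by
    intro n
    induction n using Nat.strong_induction_on with
    | _ n ih =>
      intro hn
      have hbn : ContDiff ℝ ((n : WithTop ℕ∞) + 1) b := hb.of_le (by exact_mod_cast hn)
      exact (LocBddDeriv.periodic_comp hc hyc hv (fun m hm => ih m hm (hm.trans hn))
        (contDiff_succ_iff_deriv.1 hbn).2.2 hbper.deriv).integral.of_abs.exp
  convert (LocBddDeriv.periodic_comp hc hyc hv hvn hb hbper).integral using 3 with t x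
  rw [intervalIntegral.integral_eq_sub_of_hasDerivAt (fun s _ => hyode x s)
    ((hb.continuous.comp (hyc x)).intervalIntegrable _ _), hy0]

end Flow

section Composition

open Polynomial

variable {w : ℝ → ℝ} {φ v : ℝ → ℝ → ℝ} {n : ℕ}

theorem contDiff_succ_of_hasDerivAt (hv : ∀ t x, HasDerivAt (φ t) (v t x) x)
    (hvn : LocBddDeriv w n v) (t : ℝ) : ContDiff ℝ ((n : WithTop ℕ∞) + 1) (φ t) := by
  have hd : deriv (φ t) = v t := funext fun x => (hv t x).deriv
  exact contDiff_succ_iff_deriv.2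
    ⟨fun x => (hv t x).differentiableAt, by simp, by rw [hd]; exact hvn.contDiff t⟩

theorem hasDerivAt_eval_comp (hv : ∀ t x, HasDerivAt (φ t) (v t x) x) (P : ℝ[X]) (t x : ℝ) :
    HasDerivAt (fun z => P.eval (φ t z)) (P.derivative.eval (φ t x) * v t x) x :=
  (P.hasDerivAt (φ t x)).comp x (hv t x)

/-- Derivatives of `P(φ_t) s_t` inherit the weight of `s`. -/
theorem exists_abs_iteratedDeriv_eval_mul_le (hw : ∀ t, 0 ≤ w t)
    (hv : ∀ t x, HasDerivAt (φ t) (v t x) x) (hvn : LocBddDeriv (fun _ => 1) n v)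
    {s : ℝ → ℝ → ℝ} (hs : LocBddDeriv w n s) (R : ℝ) :
    ∃ C, 0 ≤ C ∧ ∀ (P : ℝ[X]) (t : ℝ), |t| ≤ R → ∀ x,
      |iteratedDeriv n (fun z => P.eval (φ t z) * s t z) x| ≤
        C * w t * ∑ p ∈ Finset.range (n + 1), |(derivative^[p] P).eval (φ t x)| := by
  induction n generalizing s with
  | zero =>
    obtain ⟨C, hC, h⟩ := hs.2.2 R
    refine ⟨C, hC, fun P t ht x => ?_⟩
    simp only [iteratedDeriv_zero, abs_mul, zero_add, Finset.range_one, Finset.sum_singleton,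
      Function.iterate_zero, id]
    rw [mul_comm]
    exact mul_le_mul_of_nonneg_right (h t ht x) (abs_nonneg _)
  | succ n ih =>
    have hsv := hs.of_succ.mul hvn.of_succ
    obtain ⟨-, s', hs', hs'n⟩ := hs
    obtain ⟨C, hC, h⟩ := ih hvn.of_succ hsv
    obtain ⟨D, hD, h'⟩ := ih hvn.of_succ hs'n
    refine ⟨C + D, by positivity, fun P t ht x => ?_⟩
    have hder : deriv (fun z => P.eval (φ t z) * s t z) =
        (fun z => P.derivative.eval (φ t z) * (s t z * v t z)) +
          fun z => P.eval (φ t z) * s' t z := by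
      funext z
      rw [((hasDerivAt_eval_comp hv P t z).fun_mul (hs' t z)).deriv]
      simp only [Pi.add_apply]
      ring
    have hφn : ContDiff ℝ n (φ t) :=
      (contDiff_succ_of_hasDerivAt hv hvn.of_succ t).of_le (by exact_mod_cast n.le_succ)
    have hP (Q : ℝ[X]) : ContDiff ℝ n fun z => Q.eval (φ t z) := by
      simpa [Function.comp_def] using (Q.contDiff_aeval (𝕜 := ℝ) n).comp hφn
    rw [iteratedDeriv_succ', hder, iteratedDeriv_add
      ((hP _).mul (hsv.contDiff t)).contDiffAt ((hP _).mul (hs'n.contDiff t)).contDiffAt]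
    refine (abs_add_le _ _).trans ?_
    have h1 := h P.derivative t ht x
    have h2 := h' P t ht x
    simp only [← Function.iterate_succ_apply] at h1
    have e1 : ∑ p ∈ Finset.range (n + 1), |(derivative^[p + 1] P).eval (φ t x)| ≤
        ∑ p ∈ Finset.range (n + 1 + 1), |(derivative^[p] P).eval (φ t x)| := by
      rw [Finset.sum_range_succ' _ (n + 1)]
      exact le_add_of_nonneg_right (abs_nonneg _)
    have e2 : ∑ p ∈ Finset.range (n + 1), |(derivative^[p] P).eval (φ t x)| ≤
        ∑ p ∈ Finset.range (n + 1 + 1), |(derivative^[p] P).eval (φ t x)| := by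
      rw [Finset.sum_range_succ _ (n + 1)]
      exact le_add_of_nonneg_right (abs_nonneg _)
    have h3 := mul_le_mul_of_nonneg_left e1 (mul_nonneg hC (hw t))
    have h4 := mul_le_mul_of_nonneg_left e2 (mul_nonneg hD (hw t))
    linarith

/-- Up to terms carrying the weight `w`, the `n`-th derivative of `P ∘ φ_t` is
`P^{(n)} ∘ φ_t` when `φ_t' - 1` carries the weight `w`. -/
theorem exists_abs_iteratedDeriv_eval_comp_sub_le {g : ℝ → ℝ → ℝ} (hw : ∀ t, 0 ≤ w t)
    (hg : ∀ t x, HasDerivAt (φ t) (1 + g t x) x) (hgn : ∀ m < n, LocBddDeriv w m g)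
    (hgn1 : ∀ m < n, LocBddDeriv (fun _ => 1) m g) (R : ℝ) :
    ∃ C, 0 ≤ C ∧ ∀ (P : ℝ[X]) (t : ℝ), |t| ≤ R → ∀ x,
      |iteratedDeriv n (fun z => P.eval (φ t z)) x - (derivative^[n] P).eval (φ t x)| ≤
        C * w t * ∑ p ∈ Finset.range n, |(derivative^[p + 1] P).eval (φ t x)| := by
  induction n with
  | zero => exact ⟨0, le_rfl, fun P t _ x => by simp⟩
  | succ n ih =>
    have hv : LocBddDeriv (fun _ => 1) n fun t x => 1 + g t x :=
      (LocBddDeriv.const 1).add (hgn1 n n.lt_succ_self)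
    have hgw := hgn n n.lt_succ_self
    obtain ⟨C, hC, h⟩ := ih (fun m hm => hgn m (by omega)) fun m hm => hgn1 m (by omega)
    obtain ⟨D, hD, h'⟩ := exists_abs_iteratedDeriv_eval_mul_le hw hg hv hgw R
    refine ⟨C + D, by positivity, fun P t ht x => ?_⟩
    have hder : deriv (fun z => P.eval (φ t z)) =
        (fun z => P.derivative.eval (φ t z)) + fun z => P.derivative.eval (φ t z) * g t z := by
      funext z
      rw [(hasDerivAt_eval_comp hg P t z).deriv]
      simp only [Pi.add_apply]
      ring
    have hφn : ContDiff ℝ n (φ t) :=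
      (contDiff_succ_of_hasDerivAt hg hv t).of_le (by exact_mod_cast n.le_succ)
    have hP (Q : ℝ[X]) : ContDiff ℝ n fun z => Q.eval (φ t z) := by
      simpa [Function.comp_def] using (Q.contDiff_aeval (𝕜 := ℝ) n).comp hφn
    rw [iteratedDeriv_succ', hder, iteratedDeriv_add (hP _).contDiffAt
      ((hP _).mul (hgw.contDiff t)).contDiffAt, add_sub_right_comm]
    refine (abs_add_le _ _).trans ?_
    have h1 := h P.derivative t ht x
    have h2 := h' P.derivative t ht x
    simp only [← Function.iterate_succ_apply] at h1 h2
    have e1 : ∑ p ∈ Finset.range n, |(derivative^[p + 1 + 1] P).eval (φ t x)| ≤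
        ∑ p ∈ Finset.range (n + 1), |(derivative^[p + 1] P).eval (φ t x)| := by
      rw [Finset.sum_range_succ' _ n]
      exact le_add_of_nonneg_right (abs_nonneg _)
    have h3 := mul_le_mul_of_nonneg_left e1 (mul_nonneg hC (hw t))
    linarith

theorem Polynomial.iteratedDeriv_eval (P : ℝ[X]) (p : ℕ) (x : ℝ) :
    iteratedDeriv p (fun t => P.eval t) x = (derivative^[p] P).eval x := by
  induction p generalizing P with
  | zero => simp
  | succ p ih =>
    have hder : _root_.deriv (fun t => P.eval t) = fun t => P.derivative.eval t :=
      _root_.funext fun _ => P.deriv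
    rw [iteratedDeriv_succ', hder, ih, Function.iterate_succ_apply]

end Composition

/-- Since `q ≥ k+1 > deg u`, every term of Faà di Bruno's formula for
`d^q/dx^q (u(y_x(−Δt)))` contains a derivative of the flow of order ≥ 2, each of which is
`O(Δt)`: there is a constant `C` (depending on `b`, `k`, `q`, `T` only) such that on any
interval `J`, `‖d^q/dx^q (u(y_·(−Δt)))‖_{L^∞(J)} ≤ C Δt Σ_{p=1}^k ‖u^{(p)}‖_{L^∞(y(J))}`. -/
theorem stmt4 (k q : ℕ) (hq : k + 1 ≤ q) (T : ℝ) (hT : 0 < T)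
    (b : ℝ → ℝ) (hb : ContDiff ℝ q b) (hbper : ∀ x, b (x + 1) = b x)
    (L : ℝ) (hL : ∀ x, |deriv b x| ≤ L)
    (y : ℝ → ℝ → ℝ) (hy0 : ∀ x, y x 0 = x)
    (hyode : ∀ x t, HasDerivAt (y x) (b (y x t)) t) :
    ∃ C : ℝ, 0 ≤ C ∧
      ∀ (P : Polynomial ℝ), P.natDegree ≤ k →
      ∀ Δt ∈ Set.Ioc (0:ℝ) T,
      ∀ (a c : ℝ) (Mp : ℕ → ℝ),
        (∀ p ∈ Finset.Icc 1 k, ∀ x ∈ Set.Ioo a c,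
          |iteratedDeriv p (fun t => P.eval t) (y x (-Δt))| ≤ Mp p) →
        ∀ x ∈ Set.Ioo a c,
          |iteratedDeriv q (fun z => P.eval (y z (-Δt))) x| ≤
            C * Δt * ∑ p ∈ Finset.Icc 1 k, Mp p := by
  obtain ⟨r, rfl⟩ : ∃ r, q = r + 1 := ⟨q - 1, by omega⟩
  obtain ⟨-, g, hg, hgn⟩ := locBddDeriv_flow_sub_id (by omega) one_ne_zero hb hbper hL hy0 hyode
  have hφ (t x : ℝ) : HasDerivAt (fun x => y x t) (1 + g t x) x := by
    simpa using (hasDerivAt_id' x).fun_add (hg t x)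
  obtain ⟨C, hC, h⟩ := exists_abs_iteratedDeriv_eval_comp_sub_le (n := r + 1) abs_nonneg hφ
    (fun m hm => hgn.of_le (by omega)) (fun m hm => hgn.of_abs.of_le (by omega)) T
  refine ⟨C, hC, fun P hP Δt hΔt a c Mp hMp x hx => ?_⟩
  have habs : |-Δt| = Δt := by rw [abs_neg, abs_of_pos hΔt.1]
  have hzero (p : ℕ) (hp : k < p) : Polynomial.derivative^[p] P = 0 :=
    Polynomial.iterate_derivative_eq_zero (by omega)
  have key := h P (-Δt) (habs.le.trans hΔt.2) x
  rw [hzero (r + 1) (by omega), Polynomial.eval_zero, sub_zero, habs] at key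
  refine key.trans (mul_le_mul_of_nonneg_left ?_ (mul_nonneg hC hΔt.1.le))
  rw [← Finset.sum_subset (Finset.range_subset_range.2 (by omega : k ≤ r + 1)) fun p _ hp => by
      rw [hzero (p + 1) (by simpa using hp)]; simp,
    Finset.range_eq_Ico, Finset.sum_Ico_add' (fun p =>
      |(Polynomial.derivative^[p] P).eval (y x (-Δt))|) 0 k 1]
  refine Finset.sum_le_sum fun p hp => ?_
  rw [← Polynomial.iteratedDeriv_eval]
  exact hMp p (by simpa [Nat.lt_succ_iff] using hp) x hx
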